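/- Let α := α(I_X) and let d := dim_k (I_X)_α (the number of minimal generators of I_X of degree α). Then dim_k (I_X^2)_{2α} = C(d+1, 2); equivalently, the Hilbert function of R/I_X^2 at 2α equals C(2α+2,2) − C(d+1,2). -/

import Mathlib

open MvPolynomial

/-- The homogeneous ideal of the point of `ℙ²` represented by `v ∈ k³`:
the ideal generated by all linear forms vanishing at `v`. -/
noncomputable def pointIdeal {k : Type*} [Field k] (v : Fin 3 → k) :
    Ideal (MvPolynomial (Fin 3) k) :=
  Ideal.span {f | f.IsHomogeneous 1 ∧ MvPolynomial.eval v f = 0}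

/-- The ideal `I_X = ⋂ᵢ I_{vᵢ}` of the set of points represented by `v`. -/
noncomputable def pointsIdeal {k : Type*} [Field k] {s : ℕ} (v : Fin s → (Fin 3 → k)) :
    Ideal (MvPolynomial (Fin 3) k) :=
  ⨅ i, pointIdeal (v i)

/-- The `m`-th symbolic power `I_X^{(m)} = ⋂ᵢ I_{vᵢ}^m`. -/
noncomputable def pointsSymb {k : Type*} [Field k] {s : ℕ} (v : Fin s → (Fin 3 → k)) (m : ℕ) :
    Ideal (MvPolynomial (Fin 3) k) :=
  ⨅ i, (pointIdeal (v i)) ^ m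

/-- The degree-`t` graded component of an ideal of `k[x₀,x₁,x₂]`, as a `k`-subspace. -/
noncomputable def gradedPiece {k : Type*} [Field k]
    (I : Ideal (MvPolynomial (Fin 3) k)) (t : ℕ) :
    Submodule k (MvPolynomial (Fin 3) k) :=
  Submodule.restrictScalars k I ⊓ MvPolynomial.homogeneousSubmodule (Fin 3) k t

set_option synthInstance.maxHeartbeats 1000000
set_option maxHeartbeats 1000000

/-- The `K`-algebra map `K[s, t] → K[X][Y]`, `s ↦ X Y`, `t ↦ Y`, whose `Y`-degree records the total
degree. -/
noncomputable def gradingMap (K : Type*) [Field K] :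
    MvPolynomial (Fin 2) K →ₐ[K] Polynomial (Polynomial K) :=
  aeval ![Polynomial.C Polynomial.X * Polynomial.X, Polynomial.X]

/-- The polynomials of total degree at most `n` in two variables. -/
noncomputable def degreeFiltration (K : Type*) [Field K] (n : ℕ) :
    Submodule K (MvPolynomial (Fin 2) K) where
  carrier := {f | (gradingMap K f).natDegree ≤ n}
  add_mem' {f g} hf hg := by
    simp only [Set.mem_ofPred_eq, map_add] at *
    exact (Polynomial.natDegree_add_le _ _).trans (max_le hf hg)
  zero_mem' := by simp
  smul_mem' c f hf := by
    simp only [Set.mem_ofPred_eq, map_smul] at *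
    exact (Polynomial.natDegree_smul_le _ _).trans hf

/-- The degree `n` form of a polynomial in `s, t`, dehomogenised at `t = 1`. -/
noncomputable def topForm (K : Type*) [Field K] (n : ℕ) :
    MvPolynomial (Fin 2) K →ₗ[K] Polynomial K :=
  (Polynomial.lcoeff (Polynomial K) n).restrictScalars K ∘ₗ (gradingMap K).toLinearMap

section Filtration

variable {K : Type*} [Field K]

theorem topForm_apply (n : ℕ) (f : MvPolynomial (Fin 2) K) :
    topForm K n f = (gradingMap K f).coeff n := rfl

theorem mem_degreeFiltration {n : ℕ} {f : MvPolynomial (Fin 2) K} :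
    f ∈ degreeFiltration K n ↔ (gradingMap K f).natDegree ≤ n := Iff.rfl

theorem degreeFiltration_mono : Monotone (degreeFiltration K) :=
  fun _ _ h _ hf => le_trans (mem_degreeFiltration.1 hf) h

theorem mul_mem_degreeFiltration {m n : ℕ} {f g : MvPolynomial (Fin 2) K}
    (hf : f ∈ degreeFiltration K m) (hg : g ∈ degreeFiltration K n) :
    f * g ∈ degreeFiltration K (m + n) := by
  rw [mem_degreeFiltration, map_mul]
  exact Polynomial.natDegree_mul_le_of_le hf hg

theorem one_mem_degreeFiltration (n : ℕ) :
    (1 : MvPolynomial (Fin 2) K) ∈ degreeFiltration K n := by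
  simp [mem_degreeFiltration]

theorem X_mem_degreeFiltration (i : Fin 2) :
    (X i : MvPolynomial (Fin 2) K) ∈ degreeFiltration K 1 := by
  rw [mem_degreeFiltration]
  fin_cases i
  · simp [gradingMap]
  · simp [gradingMap]

theorem topForm_mul {m n : ℕ} {f g : MvPolynomial (Fin 2) K}
    (hf : f ∈ degreeFiltration K m) (hg : g ∈ degreeFiltration K n) :
    topForm K (m + n) (f * g) = topForm K m f * topForm K n g := by
  simp only [topForm_apply, map_mul]
  exact Polynomial.coeff_mul_add_eq_of_natDegree_le hf hg

theorem topForm_eq_zero_of_lt {m n : ℕ} {f : MvPolynomial (Fin 2) K}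
    (hf : f ∈ degreeFiltration K m) (h : m < n) : topForm K n f = 0 :=
  Polynomial.coeff_eq_zero_of_natDegree_lt (lt_of_le_of_lt hf h)

theorem mem_degreeFiltration_of_topForm_eq_zero {n : ℕ} {f : MvPolynomial (Fin 2) K}
    (hf : f ∈ degreeFiltration K (n + 1)) (h : topForm K (n + 1) f = 0) :
    f ∈ degreeFiltration K n := by
  rw [mem_degreeFiltration] at *
  rw [topForm_apply] at h
  refine Polynomial.natDegree_le_iff_coeff_eq_zero.2 fun N hN => ?_
  rcases eq_or_lt_of_le (Nat.succ_le_of_lt hN) with rfl | hlt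
  · exact h
  · exact Polynomial.coeff_eq_zero_of_natDegree_lt (lt_of_le_of_lt hf hlt)

theorem topForm_X_zero_mul (n : ℕ) (f : MvPolynomial (Fin 2) K) :
    topForm K (n + 1) (X 0 * f) = Polynomial.X * topForm K n f := by
  simp [topForm_apply, gradingMap, mul_assoc]

theorem topForm_X_one_mul (n : ℕ) (f : MvPolynomial (Fin 2) K) :
    topForm K (n + 1) (X 1 * f) = topForm K n f := by
  simp [topForm_apply, gradingMap]

theorem coeff_topForm (n e : ℕ) (f : MvPolynomial (Fin 2) K) :
    (topForm K n f).coeff e =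
      if e ≤ n then coeff (Finsupp.single 0 e + Finsupp.single 1 (n - e)) f else 0 := by
  induction f using MvPolynomial.induction_on' with
  | add p q hp hq =>
    rw [map_add, Polynomial.coeff_add, hp, hq]
    split_ifs <;> simp
  | monomial u a =>
    have h1 : topForm K n (monomial u a) =
        if n = u 0 + u 1 then Polynomial.monomial (u 0) a else 0 := by
      have : gradingMap K (monomial u a) =
          Polynomial.monomial (u 0 + u 1) (Polynomial.monomial (u 0) a) := by
        rw [gradingMap, aeval_monomial, Finsupp.prod_fintype _ _ (by simp)]
        simp only [Fin.prod_univ_two, Matrix.cons_val_zero, Matrix.cons_val_one, mul_pow]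
        rw [← Polynomial.C_mul_X_pow_eq_monomial, ← Polynomial.C_mul_X_pow_eq_monomial]
        simp only [map_mul, map_pow, pow_add, mul_assoc]
        simp
      rw [topForm_apply, this, Polynomial.coeff_monomial]
      simp [eq_comm]
    have h2 : (u = Finsupp.single 0 e + Finsupp.single 1 (n - e)) ↔
        u 0 = e ∧ u 1 = n - e := by
      rw [Finsupp.ext_iff, Fin.forall_fin_two]; simp
    rw [h1, coeff_monomial]
    simp only [h2]
    split_ifs <;> simp [Polynomial.coeff_monomial] <;> grind

theorem natDegree_topForm_le (n : ℕ) (f : MvPolynomial (Fin 2) K) :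
    (topForm K n f).natDegree ≤ n := by
  refine Polynomial.natDegree_le_iff_coeff_eq_zero.2 fun N hN => ?_
  rw [coeff_topForm, if_neg (by omega)]

theorem totalDegree_le_of_mem_degreeFiltration {n : ℕ} {f : MvPolynomial (Fin 2) K}
    (hf : f ∈ degreeFiltration K n) : f.totalDegree ≤ n := by
  refine Finset.sup_le fun u hu => ?_
  by_contra hlt
  rw [Finsupp.sum_fintype _ _ (by simp), Fin.sum_univ_two] at hlt
  have h := coeff_topForm (u 0 + u 1) (u 0) f
  have hu' : Finsupp.single 0 (u 0) + Finsupp.single 1 (u 0 + u 1 - u 0) = u := by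
    ext i
    fin_cases i <;> simp
  rw [topForm_eq_zero_of_lt hf (by omega), if_pos (by omega), hu'] at h
  exact (mem_support_iff.1 hu) h.symm

end Filtration

section SquareFiltration

variable {K : Type*} [Field K]

/-- The elements of an ideal of total degree at most `n`. -/
noncomputable def truncation (J : Ideal (MvPolynomial (Fin 2) K)) (n : ℕ) :
    Submodule K (MvPolynomial (Fin 2) K) :=
  J.restrictScalars K ⊓ degreeFiltration K n

variable {J : Ideal (MvPolynomial (Fin 2) K)} {α : ℕ}

theorem truncation_mono : Monotone (truncation J) :=
  fun _ _ h => inf_le_inf_left _ (degreeFiltration_mono h)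

theorem X_mul_mem_truncation {n : ℕ} {f : MvPolynomial (Fin 2) K} (hf : f ∈ truncation J n)
    (i : Fin 2) : X i * f ∈ truncation J (n + 1) :=
  ⟨J.mul_mem_left _ hf.1, add_comm 1 n ▸ mul_mem_degreeFiltration (X_mem_degreeFiltration i) hf.2⟩

theorem exists_eq_C_mul_X_pow_add {n : ℕ} {p : Polynomial K} (hp : p.natDegree ≤ n + 1) :
    ∃ (c : K) (q : Polynomial K), q.natDegree ≤ n ∧ p = c • Polynomial.X ^ (n + 1) + q := by
  refine ⟨p.coeff (n + 1), p - p.coeff (n + 1) • Polynomial.X ^ (n + 1), ?_, by ring⟩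
  refine Polynomial.natDegree_le_iff_coeff_eq_zero.2 fun N hN => ?_
  rcases eq_or_lt_of_le (Nat.succ_le_of_lt hN) with rfl | hlt
  · simp
  · have : N ≠ n + 1 := by omega
    simp [Polynomial.coeff_X_pow, this, Polynomial.coeff_eq_zero_of_natDegree_lt
      (lt_of_le_of_lt hp hlt)]

theorem exists_topForm_eq
    (h1 : ∀ p : Polynomial K, p.natDegree ≤ α → ∃ f ∈ truncation J α, topForm K α f = p)
    {n : ℕ} (hn : α ≤ n) :
    ∀ p : Polynomial K, p.natDegree ≤ n → ∃ f ∈ truncation J n, topForm K n f = p := by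
  induction n, hn using Nat.le_induction with
  | base => exact h1
  | succ n hn ih =>
    intro p hp
    obtain ⟨c, q, hq, rfl⟩ := exists_eq_C_mul_X_pow_add hp
    obtain ⟨g, hg, hgq⟩ := ih q hq
    obtain ⟨f, hf, hfX⟩ := ih (Polynomial.X ^ n) (by simp)
    refine ⟨c • (X 0 * f) + X 1 * g, add_mem (Submodule.smul_mem _ _ (X_mul_mem_truncation hf 0))
      (X_mul_mem_truncation hg 1), ?_⟩
    rw [map_add, map_smul, topForm_X_zero_mul, topForm_X_one_mul, hgq, hfX, pow_succ']

theorem truncation_le_span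
    (h1 : ∀ p : Polynomial K, p.natDegree ≤ α → ∃ f ∈ truncation J α, topForm K α f = p)
    (n : ℕ) : ∀ f ∈ truncation J n, f ∈ Ideal.span (truncation J α : Set _) := by
  induction n with
  | zero => exact fun f hf => Ideal.subset_span (truncation_mono (Nat.zero_le _) hf)
  | succ n ih =>
    intro f hf
    by_cases hn : n + 1 ≤ α
    · exact Ideal.subset_span (truncation_mono hn hf)
    obtain ⟨c, q, hq, hfq⟩ := exists_eq_C_mul_X_pow_add (natDegree_topForm_le (n + 1) f)
    obtain ⟨g, hg, hgq⟩ := exists_topForm_eq h1 (by omega : α ≤ n) q hq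
    obtain ⟨e, he, heX⟩ := exists_topForm_eq h1 (by omega : α ≤ n) (Polynomial.X ^ n) (by simp)
    have hr : c • (X 0 * e) + X 1 * g ∈ truncation J (n + 1) :=
      add_mem (Submodule.smul_mem _ _ (X_mul_mem_truncation he 0)) (X_mul_mem_truncation hg 1)
    have hd : f - (c • (X 0 * e) + X 1 * g) ∈ truncation J n := by
      refine ⟨(sub_mem hf hr).1, mem_degreeFiltration_of_topForm_eq_zero (sub_mem hf hr).2 ?_⟩
      rw [map_sub, map_add, map_smul, topForm_X_zero_mul, topForm_X_one_mul, hgq, heX, hfq,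
        pow_succ', sub_self]
    rw [← sub_add_cancel f (c • (X 0 * e) + X 1 * g)]
    refine add_mem (ih _ hd) (add_mem ?_ (Ideal.mul_mem_left _ _ (ih _ hg)))
    rw [smul_eq_C_mul]
    exact Ideal.mul_mem_left _ _ (Ideal.mul_mem_left _ _ (ih _ he))

theorem exists_mem_truncation (f : MvPolynomial (Fin 2) K) (hf : f ∈ J) :
    ∃ n, f ∈ truncation J n := ⟨_, hf, le_refl (gradingMap K f).natDegree⟩

theorem exists_mem_truncation_mul
    (h1 : ∀ p : Polynomial K, p.natDegree ≤ α → ∃ f ∈ truncation J α, topForm K α f = p)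
    {x : MvPolynomial (Fin 2) K} (hx : x ∈ J ^ 2) :
    ∃ n, α ≤ n ∧ x ∈ truncation J α * truncation J n := by
  have hadd : ∀ x y : MvPolynomial (Fin 2) K,
      (∃ n, α ≤ n ∧ x ∈ truncation J α * truncation J n) →
      (∃ n, α ≤ n ∧ y ∈ truncation J α * truncation J n) →
      ∃ n, α ≤ n ∧ x + y ∈ truncation J α * truncation J n := by
    rintro x y ⟨m, hm, hx⟩ ⟨n, hn, hy⟩
    exact ⟨max m n, by omega, add_mem
      (mul_le_mul' le_rfl (truncation_mono (le_max_left m n)) hx)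
      (mul_le_mul' le_rfl (truncation_mono (le_max_right m n)) hy)⟩
  rw [pow_two] at hx
  refine Submodule.mul_induction_on hx (fun a ha b hb => ?_) hadd
  obtain ⟨n, hn⟩ := exists_mem_truncation a ha
  have ha' := truncation_le_span h1 n a hn
  clear hn ha
  induction ha' using Submodule.span_induction generalizing b with
  | mem w hw =>
    obtain ⟨m, hm⟩ := exists_mem_truncation b hb
    exact ⟨max α m, le_max_left _ _,
      Submodule.mul_mem_mul hw (truncation_mono (le_max_right _ _) hm)⟩
  | zero => exact ⟨α, le_rfl, by simp⟩
  | add a a' _ _ iha iha' => rw [add_mul]; exact hadd _ _ (iha b hb) (iha' b hb)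
  | smul p a _ ih =>
    rw [smul_eq_mul, mul_comm p a, mul_assoc]
    exact ih _ (J.mul_mem_left p hb)

theorem mem_mul_truncation_of_mem_degreeFiltration
    (h0 : ∀ f ∈ truncation J α, topForm K α f = 0 → f = 0)
    (h1 : ∀ p : Polynomial K, p.natDegree ≤ α → ∃ f ∈ truncation J α, topForm K α f = p)
    {n : ℕ} (hn : α ≤ n) {x : MvPolynomial (Fin 2) K}
    (hx : x ∈ truncation J α * truncation J (n + 1)) (hdeg : x ∈ degreeFiltration K (α + n)) :
    x ∈ truncation J α * truncation J n := by
  choose v hv hvX using fun i : Fin (α + 1) =>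
    h1 (Polynomial.X ^ (i : ℕ)) (by simpa using Nat.lt_succ_iff.1 i.2)
  obtain ⟨q, hq, hqX⟩ := exists_topForm_eq h1 (by omega : α ≤ n + 1) (Polynomial.X ^ (n + 1))
    (by simp)
  obtain ⟨e, he, heX⟩ := exists_topForm_eq h1 hn (Polynomial.X ^ n) (by simp)
  have hreduce : ∀ i : ℕ, ∀ hi : i < α + 1, ∀ g ∈ truncation J (n + 1),
      ∃ g' ∈ truncation J (n + 1), ∃ c : Fin (α + 1) → K, c 0 = 0 ∧
        v ⟨i, hi⟩ * g - v 0 * g' - (∑ j, c j • v j) * q ∈ truncation J α * truncation J n := by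
    intro i
    induction i with
    | zero => exact fun hi g hg => ⟨g, hg, 0, rfl, by simp⟩
    | succ i ih =>
      intro hi g hg
      obtain ⟨c, p, hp, hgp⟩ := exists_eq_C_mul_X_pow_add (natDegree_topForm_le (n + 1) g)
      obtain ⟨r, hr, hrp⟩ := exists_topForm_eq h1 hn p hp
      obtain ⟨g', hg', d, hd0, hd⟩ := ih (by omega) (X 0 * r) (X_mul_mem_truncation hr 0)
      have hlow : g - c • q - X 1 * r ∈ truncation J n := by
        have hmem : g - c • q - X 1 * r ∈ truncation J (n + 1) :=
          sub_mem (sub_mem hg (Submodule.smul_mem _ _ hq)) (X_mul_mem_truncation hr 1)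
        refine ⟨hmem.1, mem_degreeFiltration_of_topForm_eq_zero hmem.2 ?_⟩
        rw [map_sub, map_sub, map_smul, topForm_X_one_mul, hgp, hqX, hrp]
        ring
      have hsyz : X 1 * v ⟨i + 1, hi⟩ - X 0 * v ⟨i, (Nat.lt_succ_self i).trans hi⟩ ∈
          truncation J α := by
        have hmem : X 1 * v ⟨i + 1, hi⟩ - X 0 * v ⟨i, (Nat.lt_succ_self i).trans hi⟩ ∈
            truncation J (α + 1) :=
          sub_mem (X_mul_mem_truncation (hv _) 1) (X_mul_mem_truncation (hv _) 0)
        refine ⟨hmem.1, mem_degreeFiltration_of_topForm_eq_zero hmem.2 ?_⟩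
        rw [map_sub, topForm_X_one_mul, topForm_X_zero_mul, hvX, hvX, pow_succ', sub_self]
      refine ⟨g', hg', d + Pi.single ⟨i + 1, hi⟩ c, ?_, ?_⟩
      · rw [Pi.add_apply, hd0, zero_add, Pi.single_eq_of_ne]
        simp [Fin.ext_iff]
      · have hsum : ∑ j, (d + Pi.single ⟨i + 1, hi⟩ c : Fin (α + 1) → K) j • v j =
            ∑ j, d j • v j + c • v ⟨i + 1, hi⟩ := by
          simp [add_smul, Finset.sum_add_distrib, Pi.single_apply, ite_smul]
        rw [hsum]
        have := add_mem (add_mem hd (Submodule.mul_mem_mul (hv ⟨i + 1, hi⟩) hlow))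
          (Submodule.mul_mem_mul hsyz hr)
        convert this using 1
        simp only [smul_eq_C_mul]
        ring
  have hform : ∃ g ∈ truncation J (n + 1), ∃ c : Fin (α + 1) → K, c 0 = 0 ∧
      x - v 0 * g - (∑ j, c j • v j) * q ∈ truncation J α * truncation J n := by
    refine Submodule.mul_induction_on hx (fun w hw g hg => ?_) ?_
    · choose G hG C hC0 hC using fun i : Fin (α + 1) => hreduce i i.2 g hg
      have hw' : w = ∑ i : Fin (α + 1), (topForm K α w).coeff i • v i := by
        rw [← sub_eq_zero]
        refine h0 _ (sub_mem hw (sum_mem fun i _ => Submodule.smul_mem _ _ (hv i))) ?_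
        simp only [map_sub, map_sum, map_smul, hvX]
        rw [sub_eq_zero, Fin.sum_univ_eq_sum_range
          (fun i => (topForm K α w).coeff i • (Polynomial.X : Polynomial K) ^ i)]
        simp only [Polynomial.smul_eq_C_mul]
        exact Polynomial.as_sum_range' _ _ (Nat.lt_succ_of_le (natDegree_topForm_le α w)) |>.trans
          (by simp only [Polynomial.C_mul_X_pow_eq_monomial])
      set a := fun i : Fin (α + 1) => (topForm K α w).coeff i
      refine ⟨∑ i, a i • G i, sum_mem fun i _ => Submodule.smul_mem _ _ (hG i),
        fun j => ∑ i, a i * C i j, by simp [hC0], ?_⟩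
      convert sum_mem (t := Finset.univ)
        (fun i _ => Submodule.smul_mem (truncation J α * truncation J n) (a i) (hC i)) using 1
      simp only [smul_sub, Finset.sum_sub_distrib]
      congr 1
      · congr 1
        · conv_lhs => rw [hw']
          simp [Finset.sum_mul, a]
        · simp [Finset.mul_sum]
      · simp only [Finset.sum_smul, ← smul_mul_assoc, ← Finset.sum_mul, Finset.smul_sum, smul_smul]
        rw [Finset.sum_comm]
    · rintro x y ⟨g, hg, c, hc0, hc⟩ ⟨g', hg', c', hc0', hc'⟩
      refine ⟨g + g', add_mem hg hg', c + c', by simp [hc0, hc0'], ?_⟩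
      convert add_mem hc hc' using 1
      simp only [Pi.add_apply, add_smul, Finset.sum_add_distrib]
      ring
  obtain ⟨g, hg, c, hc0, hc⟩ := hform
  have hle : truncation J α * truncation J n ≤ degreeFiltration K (α + n) :=
    Submodule.mul_le.2 fun a ha b hb => mul_mem_degreeFiltration ha.2 hb.2
  have hS : ∑ j, c j • v j ∈ degreeFiltration K α :=
    sum_mem fun j _ => Submodule.smul_mem _ _ (hv j).2
  have htop : topForm K (n + 1) g +
      (∑ j, c j • (Polynomial.X : Polynomial K) ^ (j : ℕ)) * Polynomial.X ^ (n + 1) = 0 := by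
    have h := topForm_eq_zero_of_lt (sub_mem hdeg (hle hc)) (by omega : α + n < α + (n + 1))
    rw [show x - (x - v 0 * g - (∑ j, c j • v j) * q) = v 0 * g + (∑ j, c j • v j) * q by ring,
      map_add, topForm_mul (hv 0).2 hg.2, topForm_mul hS hq.2, hqX, hvX, map_sum] at h
    simpa only [map_smul, hvX, Fin.val_zero, pow_zero, one_mul] using h
  have hc' : ∀ j, c j = 0 := by
    intro j
    rcases Nat.eq_zero_or_pos (j : ℕ) with hj | hj
    · rwa [show j = 0 from Fin.ext hj]
    have h := congrArg (fun p => Polynomial.coeff p ((j : ℕ) + (n + 1))) htop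
    simp only [Polynomial.coeff_add, Polynomial.coeff_mul_X_pow, Polynomial.coeff_zero,
      Polynomial.finsetSum_coeff, Polynomial.coeff_smul, Polynomial.coeff_X_pow] at h
    rw [Polynomial.coeff_eq_zero_of_natDegree_lt
      (lt_of_le_of_lt (natDegree_topForm_le _ _) (by omega))] at h
    simpa [Fin.val_inj] using h
  simp only [hc', zero_smul, Finset.sum_const_zero, zero_mul, add_zero, sub_zero] at htop hc
  rw [← sub_add_cancel x (v 0 * g)]
  exact add_mem hc (Submodule.mul_mem_mul (hv 0)
    ⟨hg.1, mem_degreeFiltration_of_topForm_eq_zero hg.2 htop⟩)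

theorem mem_truncation_mul_self
    (h0 : ∀ f ∈ truncation J α, topForm K α f = 0 → f = 0)
    (h1 : ∀ p : Polynomial K, p.natDegree ≤ α → ∃ f ∈ truncation J α, topForm K α f = p)
    {x : MvPolynomial (Fin 2) K} (hx : x ∈ J ^ 2) (hdeg : x ∈ degreeFiltration K (2 * α)) :
    x ∈ truncation J α * truncation J α := by
  obtain ⟨n, hn, hxn⟩ := exists_mem_truncation_mul h1 hx
  induction n, hn using Nat.le_induction with
  | base => exact hxn
  | succ n hn ih =>
    exact ih (mem_mul_truncation_of_mem_degreeFiltration h0 h1 hn hxn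
      (degreeFiltration_mono (by omega) hdeg))

end SquareFiltration

section Dimension

theorem finrank_map_add_finrank_inf_ker {K V W : Type*} [Field K] [AddCommGroup V] [Module K V]
    [AddCommGroup W] [Module K W] (N : Submodule K V) [FiniteDimensional K N] (f : V →ₗ[K] W) :
    Module.finrank K (N.map f) + Module.finrank K (N ⊓ f.ker : Submodule K V) =
      Module.finrank K N := by
  rw [← LinearMap.finrank_range_add_finrank_ker (f.domRestrict N), LinearMap.range_domRestrict,
    LinearMap.ker_domRestrict, ← Submodule.finrank_map_subtype_eq N, Submodule.map_comap_subtype]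

theorem finrank_le_finrank_inf_iInf_ker_add {K V ι : Type*} [Field K] [AddCommGroup V]
    [Module K V] (N : Submodule K V) [FiniteDimensional K N] (c : ℕ) (Q : ι → Submodule K V)
    (s : Finset ι) (hfin : ∀ i ∈ s, FiniteDimensional K (V ⧸ Q i))
    (hc : ∀ i ∈ s, Module.finrank K (V ⧸ Q i) ≤ c) :
    Module.finrank K N ≤
      Module.finrank K (N ⊓ ⨅ i ∈ s, Q i : Submodule K V) + c * s.card := by
  classical
  induction s using Finset.induction_on with
  | empty => rw [show (N ⊓ ⨅ i ∈ (∅ : Finset ι), Q i) = N by simp]; simp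
  | insert a s ha ih =>
    have h1 := ih (fun i hi => hfin i (Finset.mem_insert_of_mem hi))
      (fun i hi => hc i (Finset.mem_insert_of_mem hi))
    have : FiniteDimensional K (N ⊓ ⨅ i ∈ s, Q i : Submodule K V) :=
      Submodule.finiteDimensional_of_le inf_le_left
    have := hfin a (Finset.mem_insert_self a s)
    have h2 := finrank_map_add_finrank_inf_ker (N ⊓ ⨅ i ∈ s, Q i) (Q a).mkQ
    have h3 := (Submodule.finrank_le ((N ⊓ ⨅ i ∈ s, Q i).map (Q a).mkQ)).trans
      (hc a (Finset.mem_insert_self a s))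
    rw [Submodule.ker_mkQ, inf_assoc, inf_comm _ (Q a), ← Finset.iInf_insert] at h2
    rw [Finset.card_insert_of_notMem ha, mul_add]
    omega

variable {K : Type*} [Field K]

instance (n : ℕ) : FiniteDimensional K (degreeFiltration K n) :=
  Submodule.finiteDimensional_of_le (S₂ := restrictTotalDegree (Fin 2) K n)
    fun _ hf => (mem_restrictTotalDegree _ _ _).2 (totalDegree_le_of_mem_degreeFiltration hf)

instance (J : Ideal (MvPolynomial (Fin 2) K)) (n : ℕ) : FiniteDimensional K (truncation J n) :=
  Submodule.finiteDimensional_of_le (S₂ := degreeFiltration K n) inf_le_right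

theorem eq_zero_of_topForm_eq_zero {f : MvPolynomial (Fin 2) K} (h : ∀ n, topForm K n f = 0) :
    f = 0 := by
  ext u
  have hu := coeff_topForm (u 0 + u 1) (u 0) f
  have hu' : Finsupp.single 0 (u 0) + Finsupp.single 1 (u 0 + u 1 - u 0) = u := by
    ext i
    fin_cases i <;> simp
  rw [h, if_pos (by omega), hu'] at hu
  simpa using hu.symm

theorem mem_degreeLT_succ_iff {n : ℕ} {p : Polynomial K} :
    p ∈ Polynomial.degreeLT K (n + 1) ↔ p.natDegree ≤ n := by
  rw [Polynomial.mem_degreeLT, Polynomial.degree_lt_iff_coeff_zero,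
    Polynomial.natDegree_le_iff_coeff_eq_zero]
  rfl

theorem finrank_degreeLT (n : ℕ) : Module.finrank K (Polynomial.degreeLT K n) = n := by
  rw [(Polynomial.degreeLTEquiv K n).finrank_eq, Module.finrank_fin_fun]

theorem finrank_map_topForm_le (n : ℕ) (N : Submodule K (MvPolynomial (Fin 2) K)) :
    Module.finrank K (N.map (topForm K n)) ≤ n + 1 := by
  have : FiniteDimensional K (Polynomial.degreeLT K (n + 1)) :=
    Module.Finite.equiv (Polynomial.degreeLTEquiv K (n + 1)).symm
  refine (Submodule.finrank_mono ?_).trans_eq (finrank_degreeLT (K := K) (n + 1))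
  rintro _ ⟨f, -, rfl⟩
  exact mem_degreeLT_succ_iff.2 (natDegree_topForm_le n f)

theorem map_topForm_degreeFiltration (n : ℕ) :
    (degreeFiltration K n).map (topForm K n) = Polynomial.degreeLT K (n + 1) := by
  apply le_antisymm
  · rintro _ ⟨f, -, rfl⟩
    exact mem_degreeLT_succ_iff.2 (natDegree_topForm_le n f)
  · intro p hp
    obtain ⟨f, hf, hfp⟩ := exists_topForm_eq (K := K) (J := ⊤) (α := 0) (fun p hp =>
      ⟨C (p.coeff 0), ⟨trivial, by simp [mem_degreeFiltration, ← algebraMap_eq]⟩, by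
        rw [Polynomial.eq_C_of_natDegree_le_zero hp]
        simp [topForm_apply, ← algebraMap_eq]
        ⟩) (Nat.zero_le n) p (mem_degreeLT_succ_iff.1 hp)
    exact ⟨f, hf.2, hfp⟩

theorem finrank_degreeFiltration (n : ℕ) :
    Module.finrank K (degreeFiltration K n) = (n + 2).choose 2 := by
  induction n with
  | zero =>
    rw [← finrank_map_add_finrank_inf_ker _ (topForm K 0), map_topForm_degreeFiltration,
      finrank_degreeLT, show degreeFiltration K 0 ⊓ (topForm K 0).ker = ⊥ from ?_, finrank_bot]
    · rfl
    refine (Submodule.eq_bot_iff _).2 fun f hf => eq_zero_of_topForm_eq_zero fun n => ?_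
    rcases Nat.eq_zero_or_pos n with rfl | hn
    · exact hf.2
    · exact topForm_eq_zero_of_lt hf.1 hn
  | succ n ih =>
    rw [← finrank_map_add_finrank_inf_ker _ (topForm K (n + 1)), map_topForm_degreeFiltration,
      finrank_degreeLT, show degreeFiltration K (n + 1) ⊓ (topForm K (n + 1)).ker =
        degreeFiltration K n from ?_, ih, Nat.choose_succ_succ' (n + 2) 1]
    · simp
    ext f
    exact ⟨fun h => mem_degreeFiltration_of_topForm_eq_zero h.1 h.2, fun h =>
      ⟨degreeFiltration_mono (Nat.le_succ n) h, topForm_eq_zero_of_lt h (Nat.lt_succ_self n)⟩⟩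

/-- The maximal ideal of a point of the affine plane. -/
noncomputable def affinePointIdeal (p : Fin 2 → K) : Ideal (MvPolynomial (Fin 2) K) :=
  RingHom.ker (eval p)

theorem exists_sub_mem_affinePointIdeal_sq (p : Fin 2 → K) (f : MvPolynomial (Fin 2) K) :
    ∃ c : Fin 3 → K, f - (C (c 0) + C (c 1) * (X 0 - C (p 0)) + C (c 2) * (X 1 - C (p 1))) ∈
      affinePointIdeal p ^ 2 := by
  have hX : ∀ i, X i - C (p i) ∈ affinePointIdeal p := fun i => by
    simp [affinePointIdeal, RingHom.mem_ker]
  have hXX : ∀ i j, (X i - C (p i)) * (X j - C (p j)) ∈ affinePointIdeal p ^ 2 := fun i j => by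
    rw [pow_two]
    exact Ideal.mul_mem_mul (hX i) (hX j)
  induction f using MvPolynomial.induction_on with
  | C a => exact ⟨![a, 0, 0], by simp⟩
  | add f g hf hg =>
    obtain ⟨c, hc⟩ := hf
    obtain ⟨d, hd⟩ := hg
    refine ⟨c + d, ?_⟩
    convert add_mem hc hd using 1
    simp only [Pi.add_apply, C_add]
    ring
  | mul_X f i hf =>
    obtain ⟨c, hc⟩ := hf
    have h := Ideal.mul_mem_right (X i) _ hc
    have h1 := Ideal.mul_mem_left _ (C (c 1)) (hXX i 0)
    have h2 := Ideal.mul_mem_left _ (C (c 2)) (hXX i 1)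
    refine ⟨p i • c + c 0 • ![0, if i = 0 then 1 else 0, if i = 1 then 1 else 0], ?_⟩
    convert add_mem (add_mem h h1) h2 using 1
    fin_cases i <;> simp <;> ring

theorem exists_linearMap_surjective (p : Fin 2 → K) :
    ∃ φ : (Fin 3 → K) →ₗ[K]
      (MvPolynomial (Fin 2) K ⧸ (affinePointIdeal p ^ 2).restrictScalars K),
      Function.Surjective φ := by
  refine ⟨Submodule.mkQ _ ∘ₗ
    Fintype.linearCombination K ![1, X 0 - C (p 0), X 1 - C (p 1)], fun y => ?_⟩
  obtain ⟨f, rfl⟩ := Submodule.mkQ_surjective _ y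
  obtain ⟨c, hc⟩ := exists_sub_mem_affinePointIdeal_sq p f
  refine ⟨c, ?_⟩
  rw [LinearMap.comp_apply, ← sub_eq_zero, ← map_sub, Submodule.mkQ_apply,
    Submodule.Quotient.mk_eq_zero, ← neg_mem_iff]
  simpa [Fintype.linearCombination_apply, Fin.sum_univ_three, smul_eq_C_mul] using hc

/-- The ideal of a finite set of points of the affine plane. -/
noncomputable def affinePointsIdeal (Y : Finset (Fin 2 → K)) : Ideal (MvPolynomial (Fin 2) K) :=
  ⨅ p ∈ Y, affinePointIdeal p

theorem mem_affinePointsIdeal {Y : Finset (Fin 2 → K)} {f : MvPolynomial (Fin 2) K} :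
    f ∈ affinePointsIdeal Y ↔ ∀ p ∈ Y, eval p f = 0 := by
  simp [affinePointsIdeal, affinePointIdeal, RingHom.mem_ker]

theorem iInf_affinePointIdeal_sq_le (Y : Finset (Fin 2 → K)) :
    ⨅ p ∈ Y, affinePointIdeal p ^ 2 ≤ affinePointsIdeal Y ^ 2 := by
  have hmax : ∀ p : Fin 2 → K, (affinePointIdeal p).IsMaximal := fun p =>
    RingHom.ker_isMaximal_of_surjective _ fun c => ⟨C c, by simp⟩
  have hne : ∀ p q : Fin 2 → K, p ≠ q → IsCoprime (affinePointIdeal p) (affinePointIdeal q) := by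
    intro p q hpq
    refine Ideal.isCoprime_of_isMaximal fun h => hpq (funext fun i => ?_)
    have : X i - C (p i) ∈ affinePointIdeal q := by
      rw [← h]; simp [affinePointIdeal, RingHom.mem_ker]
    simpa [affinePointIdeal, RingHom.mem_ker, sub_eq_zero, eq_comm] using this
  rw [affinePointsIdeal,
    ← Ideal.prod_eq_iInf_of_pairwise_isCoprime (fun p _ q _ hpq => hne p q hpq),
    ← Ideal.prod_eq_iInf_of_pairwise_isCoprime (fun p _ q _ hpq => (hne p q hpq).pow),
    Finset.prod_pow]

theorem finrank_le_finrank_inf_affinePointsIdeal_sq_add (Y : Finset (Fin 2 → K)) (n : ℕ) :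
    Module.finrank K (degreeFiltration K n) ≤
      Module.finrank K (truncation (affinePointsIdeal Y ^ 2) n) + 3 * Y.card := by
  refine (finrank_le_finrank_inf_iInf_ker_add _ 3
    (fun p => (affinePointIdeal p ^ 2).restrictScalars K) Y ?_ ?_).trans
      (Nat.add_le_add_right (Submodule.finrank_mono ?_) _)
  · intro p _
    obtain ⟨φ, hφ⟩ := exists_linearMap_surjective p
    exact Module.Finite.of_surjective φ hφ
  · intro p _
    obtain ⟨φ, hφ⟩ := exists_linearMap_surjective p
    simpa using LinearMap.finrank_le_finrank_of_surjective hφ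
  · intro f hf
    refine ⟨iInf_affinePointIdeal_sq_le Y ?_, hf.1⟩
    simpa using hf.2

theorem finrank_le_finrank_truncation_affinePointsIdeal_add (Y : Finset (Fin 2 → K)) (n : ℕ) :
    Module.finrank K (degreeFiltration K n) ≤
      Module.finrank K (truncation (affinePointsIdeal Y) n) + Y.card := by
  have key : ∀ p : Fin 2 → K, Nonempty
      ((MvPolynomial (Fin 2) K ⧸ (aeval p : MvPolynomial (Fin 2) K →ₐ[K] K).toLinearMap.ker)
        ≃ₗ[K] K) := fun p =>
    ⟨LinearMap.quotKerEquivOfSurjective _ fun c => ⟨C c, by simp⟩⟩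
  have h := finrank_le_finrank_inf_iInf_ker_add (degreeFiltration K n) 1
    (fun p => (aeval p : MvPolynomial (Fin 2) K →ₐ[K] K).toLinearMap.ker) Y
    (fun p _ => Module.Finite.equiv (key p).some.symm)
    (fun p _ => by rw [(key p).some.finrank_eq, Module.finrank_self])
  rw [one_mul] at h
  refine h.trans (Nat.add_le_add_right (Submodule.finrank_mono ?_) _)
  intro f hf
  refine ⟨mem_affinePointsIdeal.2 fun p hp => ?_, hf.1⟩
  simpa [aeval_eq_eval] using (Submodule.mem_iInf _).1 ((Submodule.mem_iInf _).1 hf.2 p) hp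

end Dimension

section AffineProducts

/-- The family of products `f i * f j` indexed by unordered pairs. -/
def pairProducts {ι R : Type*} [CommSemiring R] (f : ι → R) : Sym2 ι → R :=
  Sym2.lift ⟨fun i j => f i * f j, fun _ _ => mul_comm _ _⟩

@[simp]
theorem pairProducts_mk {ι R : Type*} [CommSemiring R] (f : ι → R) (i j : ι) :
    pairProducts f s(i, j) = f i * f j := rfl

open scoped Pointwise in
theorem range_pairProducts {ι R : Type*} [CommSemiring R] (f : ι → R) :
    Set.range (pairProducts f) = Set.range f * Set.range f := by
  ext x
  simp only [Set.mem_range, Set.mem_mul, Sym2.exists, pairProducts_mk]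
  simp

theorem linearIndependent_pairProducts_of_le_finrank {K A ι : Type*} [Field K] [CommRing A]
    [Algebra K A] (W : Submodule K A) [FiniteDimensional K W]
    (hW : (Module.finrank K W + 1).choose 2 ≤ Module.finrank K (W * W : Submodule K A))
    {f : ι → A} (hf : LinearIndependent K f) (hfW : ∀ i, f i ∈ W) :
    LinearIndependent K (pairProducts f) := by
  let g : ι → W := fun i => ⟨f i, hfW i⟩
  have hg : LinearIndependent K g := LinearIndependent.of_comp W.subtype hf
  let b := Module.Basis.extend hg.linearIndepOn_id
  have : Fintype (hg.linearIndepOn_id.extend (Set.subset_univ _)) :=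
    FiniteDimensional.fintypeBasisIndex b
  let e : hg.linearIndepOn_id.extend (Set.subset_univ _) → A := fun i => (b i : A)
  let a : ι → hg.linearIndepOn_id.extend (Set.subset_univ _) := fun i =>
    ⟨g i, hg.linearIndepOn_id.subset_extend _ ⟨i, rfl⟩⟩
  have ha : Function.Injective a := fun i j hij => hg.injective (congrArg Subtype.val hij)
  have hspan : Submodule.span K (Set.range e) = W := by
    have := congrArg (Submodule.map W.subtype) b.span_eq
    rwa [Submodule.map_span, ← Set.range_comp, Submodule.map_top, Submodule.range_subtype] at this
  have he : LinearIndependent K (pairProducts e) := by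
    classical
    rw [linearIndependent_iff_card_le_finrank_span, Set.finrank, range_pairProducts,
      ← Submodule.span_mul_span, hspan, Sym2.card, ← Module.finrank_eq_card_basis b]
    exact hW
  have hcomp : pairProducts f = pairProducts e ∘ Sym2.map a := by
    funext z
    induction z with
    | h i j => simp [e, b, a, g, Module.Basis.extend_apply_self]
  rw [hcomp]
  exact he.comp _ (Sym2.map.injective ha)


theorem exists_subset_card_le_finrank {K V ι : Type*} [Field K] [AddCommGroup V] [Module K V]
    [FiniteDimensional K V] (s : Finset ι) (φ : ι → Module.Dual K V)
    (hs : ∀ x, (∀ i ∈ s, φ i x = 0) → x = 0) :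
    ∃ t ⊆ s, t.card ≤ Module.finrank K V ∧ ∀ x, (∀ i ∈ t, φ i x = 0) → x = 0 := by
  classical
  obtain ⟨κ, a, ha, hspan, hli⟩ := exists_linearIndependent' K (fun i : s => φ i)
  have : Fintype κ := Fintype.ofInjective a ha
  refine ⟨Finset.univ.image fun j => (a j : ι), ?_, ?_, fun x hx => hs x fun i hi => ?_⟩
  · intro i hi
    obtain ⟨j, -, rfl⟩ := Finset.mem_image.1 hi
    exact (a j).2
  · exact Finset.card_image_le.trans
      (hli.fintype_card_le_finrank.trans_eq Subspace.dual_finrank_eq)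
  · have hmem : φ i ∈ Submodule.span K (Set.range ((fun i : s => φ i) ∘ a)) := by
      rw [hspan]
      exact Submodule.subset_span ⟨⟨i, hi⟩, rfl⟩
    have hle : Submodule.span K (Set.range ((fun i : s => φ i) ∘ a)) ≤
        (Module.Dual.eval K V x).ker := by
      rw [Submodule.span_le]
      rintro _ ⟨j, rfl⟩
      exact hx _ (Finset.mem_image_of_mem _ (Finset.mem_univ j))
    exact hle hmem

theorem choose_two_arith (n : ℕ) :
    (2 * (n + 1) + 2).choose 2 = (n + 3).choose 2 + 3 * (n + 2).choose 2 := by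
  have h : ∀ m : ℕ, (((m + 1).choose 2 : ℕ) : ℚ) = (m + 1) * m / 2 := fun m => by
    rw [Nat.cast_choose_two]; push_cast; ring
  have h1 := h (2 * (n + 1) + 1)
  have h2 := h (n + 2)
  have h3 := h (n + 1)
  have : (((2 * (n + 1) + 2).choose 2 : ℕ) : ℚ) =
      ((n + 3).choose 2 : ℕ) + 3 * ((n + 2).choose 2 : ℕ) := by
    rw [h1, h2, h3]; push_cast; ring
  exact_mod_cast this

theorem linearIndependent_pairProducts_of_affine {K : Type*} [Field K] (X : Finset (Fin 2 → K))
    (n : ℕ)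
    (hX : ∀ f ∈ degreeFiltration K n, (∀ p ∈ X, eval p f = 0) → f = 0) {ι : Type*}
    {f : ι → MvPolynomial (Fin 2) K} (hf : LinearIndependent K f)
    (hdeg : ∀ i, f i ∈ degreeFiltration K (n + 1)) (hvan : ∀ i, ∀ p ∈ X, eval p (f i) = 0) :
    LinearIndependent K (pairProducts f) := by
  obtain ⟨Y, hYX, hYcard, hY⟩ := exists_subset_card_le_finrank X
    (fun p => (aeval p : MvPolynomial (Fin 2) K →ₐ[K] K).toLinearMap ∘ₗ
      (degreeFiltration K n).subtype)
    (fun g hg => Subtype.ext (hX g g.2 (by simpa [aeval_eq_eval] using hg)))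
  rw [finrank_degreeFiltration] at hYcard
  set J := affinePointsIdeal Y
  have hJ : ∀ g ∈ truncation J n, g = 0 := fun g hg => congrArg Subtype.val
    (hY ⟨g, hg.2⟩ (by simpa [aeval_eq_eval] using mem_affinePointsIdeal.1 hg.1))
  have h0 : ∀ g ∈ truncation J (n + 1), topForm K (n + 1) g = 0 → g = 0 := fun g hg hg0 =>
    hJ g ⟨hg.1, mem_degreeFiltration_of_topForm_eq_zero hg.2 hg0⟩
  have hrank : Module.finrank K ((truncation J (n + 1)).map (topForm K (n + 1))) =
      Module.finrank K (truncation J (n + 1)) := by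
    rw [← finrank_map_add_finrank_inf_ker (truncation J (n + 1)) (topForm K (n + 1)),
      show truncation J (n + 1) ⊓ (topForm K (n + 1)).ker = ⊥ from
        (Submodule.eq_bot_iff _).2 fun g hg => h0 g hg.1 hg.2, finrank_bot, add_zero]
  have hlower := finrank_le_finrank_truncation_affinePointsIdeal_add Y (n + 1)
  have hupper := finrank_map_topForm_le (n + 1) (truncation J (n + 1))
  rw [finrank_degreeFiltration, show (n + 1 + 2).choose 2 = n + 2 + (n + 2).choose 2 by
    rw [Nat.choose_succ_succ' (n + 2) 1, Nat.choose_one_right]] at hlower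
  have hmap : (truncation J (n + 1)).map (topForm K (n + 1)) =
      Polynomial.degreeLT K (n + 1 + 1) := by
    have : FiniteDimensional K (Polynomial.degreeLT K (n + 1 + 1)) :=
      Module.Finite.equiv (Polynomial.degreeLTEquiv K (n + 1 + 1)).symm
    refine Submodule.eq_of_le_of_finrank_le ?_ ?_
    · rintro _ ⟨g, -, rfl⟩
      exact mem_degreeLT_succ_iff.2 (natDegree_topForm_le _ g)
    · rw [finrank_degreeLT, hrank]
      change _ ≤ Module.finrank K (truncation J (n + 1)) + _ at hlower
      omega
  have h1 : ∀ p : Polynomial K, p.natDegree ≤ n + 1 →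
      ∃ g ∈ truncation J (n + 1), topForm K (n + 1) g = p := fun p hp => by
    have : p ∈ (truncation J (n + 1)).map (topForm K (n + 1)) := by
      rw [hmap]; exact mem_degreeLT_succ_iff.2 hp
    exact this
  have hfin : FiniteDimensional K
      (truncation J (n + 1) * truncation J (n + 1) : Submodule K (MvPolynomial (Fin 2) K)) :=
    Module.Finite.iff_fg.2 ((Module.Finite.iff_fg.1 inferInstance).mul
      (Module.Finite.iff_fg.1 inferInstance))
  refine linearIndependent_pairProducts_of_le_finrank (truncation J (n + 1)) ?_ hf
    fun i => ⟨mem_affinePointsIdeal.2 fun p hp => hvan i p (hYX hp), hdeg i⟩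
  have hsq := finrank_le_finrank_inf_affinePointsIdeal_sq_add Y (2 * (n + 1))
  have hle : Module.finrank K (truncation (J ^ 2) (2 * (n + 1))) ≤ Module.finrank K
      (truncation J (n + 1) * truncation J (n + 1) : Submodule K (MvPolynomial (Fin 2) K)) :=
    Submodule.finrank_mono fun g hg => mem_truncation_mul_self h0 h1 hg.1 hg.2
  rw [finrank_degreeFiltration, choose_two_arith] at hsq
  have hmono : (Module.finrank K (truncation J (n + 1)) + 1).choose 2 ≤ (n + 3).choose 2 :=
    Nat.choose_le_choose 2 (by omega)
  change _ ≤ Module.finrank K (truncation (J ^ 2) (2 * (n + 1))) + _ at hsq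
  omega

end AffineProducts

section GradedPieces

theorem aeval_mul_left_of_isHomogeneous {σ R S : Type*} [CommSemiring R]
    [CommSemiring S] [Algebra R S] {F : MvPolynomial σ R} {n : ℕ} (hF : F.IsHomogeneous n) (c : S)
    (w : σ → S) : aeval (fun i => c * w i) F = c ^ n * aeval w F := by
  simp only [aeval_def, eval₂_eq, Finset.mul_sum]
  refine Finset.sum_congr rfl fun u hu => ?_
  have hdeg : ∑ i ∈ u.support, u i = n := by
    by_contra h
    exact (mem_support_iff.1 hu) (hF.coeff_eq_zero h)
  rw [← hdeg, ← Finset.prod_pow_eq_pow_sum]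
  simp only [mul_pow, Finset.prod_mul_distrib]
  ring

variable {k : Type*} [Field k] {s : ℕ}

theorem eval_eq_zero_of_mem_pointIdeal {v : Fin 3 → k} {F : MvPolynomial (Fin 3) k}
    (hF : F ∈ pointIdeal v) : eval v F = 0 := by
  have : pointIdeal v ≤ RingHom.ker (eval v) := Ideal.span_le.2 fun f hf => hf.2
  exact this hF

theorem mem_pointIdeal_of_isHomogeneous {v : Fin 3 → k} (hv : v ≠ 0)
    {F : MvPolynomial (Fin 3) k} {n : ℕ} (hF : F.IsHomogeneous n) (h : eval v F = 0) :
    F ∈ pointIdeal v := by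
  obtain ⟨i, hi⟩ := Function.ne_iff.1 hv
  simp only [Pi.zero_apply] at hi
  let π := Ideal.Quotient.mkₐ k (pointIdeal v)
  have hX : ∀ j, π (X j) = π (C (v i)⁻¹ * X i) * algebraMap k _ (v j) := by
    intro j
    have hmem : X j - C (v i)⁻¹ * X i * C (v j) ∈ pointIdeal v := by
      refine Ideal.subset_span ⟨?_, ?_⟩
      · refine (isHomogeneous_X k j).sub ?_
        rw [mul_right_comm, ← C_mul]
        exact (isHomogeneous_X k i).C_mul _
      · simp [hi]
    rw [← sub_eq_zero, ← AlgHom.commutes π, algebraMap_eq, ← map_mul, ← map_sub]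
    exact Ideal.Quotient.eq_zero_iff_mem.2 hmem
  have hπ : π F = aeval (fun j => π (C (v i)⁻¹ * X i) * algebraMap k _ (v j)) F := by
    rw [← funext hX]
    exact DFunLike.congr_fun (aeval_unique π) F
  rw [aeval_mul_left_of_isHomogeneous hF] at hπ
  have h0 : aeval (fun j => algebraMap k (MvPolynomial (Fin 3) k ⧸ pointIdeal v) (v j)) F = 0 := by
    have := aeval_algebraMap_apply (MvPolynomial (Fin 3) k ⧸ pointIdeal v) v F
    exact this.trans ((congrArg _ h).trans (map_zero _))
  rw [h0, mul_zero] at hπ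
  exact Ideal.Quotient.eq_zero_iff_mem.1 hπ

theorem mem_gradedPiece_pointsIdeal {v : Fin s → (Fin 3 → k)} (hv : ∀ i, v i ≠ 0) {n : ℕ}
    {F : MvPolynomial (Fin 3) k} :
    F ∈ gradedPiece (pointsIdeal v) n ↔ F.IsHomogeneous n ∧ ∀ i, eval (v i) F = 0 := by
  constructor
  · exact fun h => ⟨h.2, fun i => eval_eq_zero_of_mem_pointIdeal ((Ideal.mem_iInf.1 h.1) i)⟩
  · exact fun h => ⟨Ideal.mem_iInf.2 fun i => mem_pointIdeal_of_isHomogeneous (hv i) h.1 (h.2 i),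
      h.1⟩

theorem homogeneousComponent_mem_pointsIdeal (v : Fin s → (Fin 3 → k))
    {F : MvPolynomial (Fin 3) k} (hF : F ∈ pointsIdeal v) (n : ℕ) :
    homogeneousComponent n F ∈ pointsIdeal v := by
  let _ := gradedAlgebra (σ := Fin 3) (R := k)
  have h : (pointsIdeal v).IsHomogeneous (homogeneousSubmodule (Fin 3) k) :=
    Ideal.IsHomogeneous.iInf fun i => Ideal.homogeneous_span _ _ fun f hf => ⟨1, hf.1⟩
  rw [← decomposition.decompose'_apply]
  exact h n hF

theorem gradedPiece_sq (I : Ideal (MvPolynomial (Fin 3) k)) (α : ℕ)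
    (hI : ∀ F ∈ I, ∀ n, homogeneousComponent n F ∈ I)
    (hα : ∀ n < α, gradedPiece I n = ⊥) :
    gradedPiece (I ^ 2) (2 * α) = gradedPiece I α * gradedPiece I α := by
  apply le_antisymm
  · rintro F ⟨hF, hdeg⟩
    have key : ∀ G ∈ I * I,
        homogeneousComponent (2 * α) G ∈ gradedPiece I α * gradedPiece I α := by
      intro G hG
      refine Submodule.mul_induction_on hG (fun a ha b hb => ?_) fun x y hx hy => ?_
      · rw [← sum_homogeneousComponent a, ← sum_homogeneousComponent b, Finset.sum_mul_sum,
          map_sum]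
        refine sum_mem fun i _ => ?_
        rw [map_sum]
        refine sum_mem fun j _ => ?_
        have hai : homogeneousComponent i a ∈ gradedPiece I i :=
          ⟨hI a ha i, homogeneousComponent_isHomogeneous i a⟩
        have hbj : homogeneousComponent j b ∈ gradedPiece I j :=
          ⟨hI b hb j, homogeneousComponent_isHomogeneous j b⟩
        have hij : homogeneousComponent i a * homogeneousComponent j b ∈
            homogeneousSubmodule (Fin 3) k (i + j) :=
          (homogeneousComponent_isHomogeneous i a).mul (homogeneousComponent_isHomogeneous j b)
        rw [homogeneousComponent_of_mem hij]
        split_ifs with h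
        · by_cases hi : i < α
          · rw [hα i hi, Submodule.mem_bot] at hai
            rw [hai, zero_mul]
            exact zero_mem _
          by_cases hj : j < α
          · rw [hα j hj, Submodule.mem_bot] at hbj
            rw [hbj, mul_zero]
            exact zero_mem _
          obtain rfl : i = α := by omega
          obtain rfl : j = i := by omega
          exact Submodule.mul_mem_mul hai hbj
        · exact zero_mem _
      · rw [map_add]
        exact add_mem hx hy
    have := key F (by rw [← pow_two]; exact hF)
    rwa [homogeneousComponent_of_mem hdeg, if_pos rfl] at this
  · refine Submodule.mul_le.2 fun a ha b hb => ⟨?_, ?_⟩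
    · exact pow_two I ▸ Ideal.mul_mem_mul ha.1 hb.1
    · exact two_mul α ▸ IsHomogeneous.mul ha.2 hb.2

end GradedPieces

section AffineChart

theorem exists_coeff_eq_apply_coeff {k K σ : Type*} [Field k] [Field K] [Algebra k K]
    (l : K →ₗ[k] k) (G : MvPolynomial σ K) :
    ∃ H : MvPolynomial σ k, (∀ u, coeff u H = l (coeff u G)) ∧
      ∀ v : σ → k, eval v H = l (eval (fun i => algebraMap k K (v i)) G) := by
  classical
  refine ⟨∑ u ∈ G.support, monomial u (l (coeff u G)), fun u => ?_, fun v => ?_⟩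
  · simp only [coeff_sum, coeff_monomial, Finset.sum_ite_eq', mem_support_iff, ite_not]
    split_ifs with h
    · rw [h, map_zero]
    · rfl
  · rw [eval_eq _ G, map_sum, map_sum]
    refine Finset.sum_congr rfl fun u _ => ?_
    have : coeff u G * ∏ i ∈ u.support, algebraMap k K (v i) ^ u i =
        (∏ i ∈ u.support, v i ^ u i) • coeff u G := by
      rw [Algebra.smul_def, map_prod, mul_comm]
      simp only [map_pow]
    rw [this, map_smul, eval_monomial, Finsupp.prod, smul_eq_mul, mul_comm]

/-- Dehomogenisation with respect to the linear form `x₂ + a x₀ + b x₁`, with extension of scalars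
from `k` to `K`. -/
noncomputable def affineChart (k : Type*) {K : Type*} [Field k] [Field K] [Algebra k K] (a b : K) :
    MvPolynomial (Fin 3) k →ₐ[k] MvPolynomial (Fin 2) K :=
  aeval ![X 0, X 1, 1 - C a * X 0 - C b * X 1]

/-- The linear form `x₂ + a x₀ + b x₁` whose vanishing locus is the line at infinity of
`affineChart`. -/
noncomputable def lineAtInfinity {K : Type*} [Field K] (a b : K) : MvPolynomial (Fin 3) K :=
  X 2 + C a * X 0 + C b * X 1

variable {k K : Type*} [Field k] [Field K] [Algebra k K] (a b : K)

theorem affineChart_eq_affineChart_map (F : MvPolynomial (Fin 3) k) :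
    affineChart k a b F = affineChart K a b (map (algebraMap k K) F) := by
  rw [affineChart, affineChart, aeval_map_algebraMap]

theorem affineChart_mem_degreeFiltration {F : MvPolynomial (Fin 3) k} {n : ℕ}
    (hF : F.IsHomogeneous n) : affineChart k a b F ∈ degreeFiltration K n := by
  have hX : ∀ i, (![X 0, X 1, 1 - C a * X 0 - C b * X 1] : Fin 3 → MvPolynomial (Fin 2) K) i ∈
      degreeFiltration K 1 := by
    have hC : ∀ (c : K) i, C c * X i ∈ degreeFiltration K 1 := fun c i => by
      rw [C_mul']
      exact Submodule.smul_mem _ _ (X_mem_degreeFiltration i)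
    intro i
    fin_cases i
    · exact X_mem_degreeFiltration 0
    · exact X_mem_degreeFiltration 1
    · exact sub_mem (sub_mem (one_mem_degreeFiltration 1) (hC a 0)) (hC b 1)
  have hpow : ∀ (f : MvPolynomial (Fin 2) K), f ∈ degreeFiltration K 1 → ∀ m,
      f ^ m ∈ degreeFiltration K m := by
    intro f hf m
    induction m with
    | zero => simpa using one_mem_degreeFiltration 0
    | succ m ih =>
      rw [pow_succ]
      exact mul_mem_degreeFiltration ih hf
  rw [affineChart, aeval_def, eval₂_eq]
  refine sum_mem fun u hu => ?_
  have hdeg : u 0 + u 1 + u 2 = n := by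
    rw [← hF (mem_support_iff.1 hu), Finsupp.weight_apply, Finsupp.sum_fintype _ _ (by simp)]
    simp [Fin.sum_univ_three]
  rw [IsScalarTower.algebraMap_eq k K, RingHom.comp_apply, algebraMap_eq, C_mul',
    Finset.prod_subset (Finset.subset_univ u.support) fun i _ hi => by
      rw [Finsupp.notMem_support_iff.1 hi, pow_zero], Fin.prod_univ_three, ← hdeg]
  exact Submodule.smul_mem _ _ (mul_mem_degreeFiltration (mul_mem_degreeFiltration
    (hpow _ (hX 0) _) (hpow _ (hX 1) _)) (hpow _ (hX 2) _))

theorem eval_affineChart {F : MvPolynomial (Fin 3) k} {n : ℕ} (hF : F.IsHomogeneous n)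
    {v : Fin 3 → k}
    (hv : algebraMap k K (v 2) + a * algebraMap k K (v 0) + b * algebraMap k K (v 1) ≠ 0) :
    eval (fun i : Fin 2 => algebraMap k K (v i.castSucc) /
        (algebraMap k K (v 2) + a * algebraMap k K (v 0) + b * algebraMap k K (v 1)))
      (affineChart k a b F) =
      (algebraMap k K (v 2) + a * algebraMap k K (v 0) + b * algebraMap k K (v 1))⁻¹ ^ n *
        algebraMap k K (eval v F) := by
  set l := algebraMap k K (v 2) + a * algebraMap k K (v 0) + b * algebraMap k K (v 1) with hl
  let q : Fin 2 → K := fun i => algebraMap k K (v i.castSucc) / l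
  let ψ : MvPolynomial (Fin 2) K →ₐ[k] K := (aeval q : _ →ₐ[K] K).restrictScalars k
  have hψ : ψ (affineChart k a b F) = aeval (fun i => l⁻¹ * algebraMap k K (v i)) F := by
    rw [affineChart, ← AlgHom.comp_apply, comp_aeval]
    congr 2
    funext i
    fin_cases i
    · simp [ψ, q, div_eq_inv_mul]
    · simp [ψ, q, div_eq_inv_mul]
    · have : (v (Fin.castSucc 1)) = v 1 := rfl
      simp only [ψ, q, AlgHom.restrictScalars_apply]
      simp
      field_simp
      rw [hl]
      ring
  rw [aeval_mul_left_of_isHomogeneous hF] at hψ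
  refine hψ.trans ?_
  congr 1
  exact aeval_algebraMap_apply K v F

theorem eq_zero_of_affineChart_eq_zero {F : MvPolynomial (Fin 3) K} {n : ℕ}
    (hF : F.IsHomogeneous n) (h : affineChart K a b F = 0) : F = 0 := by
  let L := FractionRing (MvPolynomial (Fin 3) K)
  let j : MvPolynomial (Fin 3) K →ₐ[K] L := Algebra.algHom K _ L
  have hj : Function.Injective j := IsFractionRing.injective (MvPolynomial (Fin 3) K) L
  have hl : j (lineAtInfinity a b) ≠ 0 := by
    rw [Ne, map_eq_zero_iff j hj]
    intro h0
    have := congrArg (eval ![0, 0, 1]) h0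
    simp [lineAtInfinity] at this
  let ψ : MvPolynomial (Fin 2) K →ₐ[K] L :=
    aeval fun i : Fin 2 => (j (lineAtInfinity a b))⁻¹ * j (X i.castSucc)
  have hψ : ψ (affineChart K a b F) =
      aeval (fun i => (j (lineAtInfinity a b))⁻¹ * j (X i)) F := by
    rw [affineChart, ← AlgHom.comp_apply, comp_aeval]
    have hC : ∀ c : K, ψ (C c) = j (C c) := fun c =>
      (AlgHom.commutes ψ c).trans (AlgHom.commutes j c).symm
    have hX : ∀ i : Fin 2, ψ (X i) = (j (lineAtInfinity a b))⁻¹ * j (X i.castSucc) :=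
      fun i => aeval_X _ i
    congr 2
    funext i
    fin_cases i
    · exact hX 0
    · exact hX 1
    · change ψ (1 - C a * X 0 - C b * X 1) = (j (lineAtInfinity a b))⁻¹ * j (X 2)
      rw [map_sub, map_sub, map_one, map_mul, map_mul, hC, hC, hX, hX,
        eq_inv_mul_iff_mul_eq₀ hl, mul_sub, mul_sub, mul_left_comm, mul_left_comm (j _) (j (C b)),
        mul_inv_cancel_left₀ hl, mul_inv_cancel_left₀ hl, mul_one, ← map_mul, ← map_mul, ← map_sub,
        ← map_sub, lineAtInfinity]
      congr 1
      change X 2 + C a * X 0 + C b * X 1 - C a * X 0 - C b * X 1 = X 2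
      ring
  rw [h, map_zero, aeval_mul_left_of_isHomogeneous hF] at hψ
  have := (mul_eq_zero.1 hψ.symm).resolve_left (pow_ne_zero _ (inv_ne_zero hl))
  have hjF : j F = 0 := (DFunLike.congr_fun (aeval_unique j) F).trans this
  exact (map_eq_zero_iff j hj).1 hjF

theorem linearIndependent_affineChart {ι : Type*} {f : ι → MvPolynomial (Fin 3) k} {n : ℕ}
    (hf : LinearIndependent k f) (hn : ∀ i, (f i).IsHomogeneous n) :
    LinearIndependent K fun i => affineChart k a b (f i) := by
  rw [linearIndependent_iff'] at hf ⊢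
  intro t c hc i hi
  have hsum : ∑ i ∈ t, C (c i) * map (algebraMap k K) (f i) = 0 := by
    refine eq_zero_of_affineChart_eq_zero a b (n := n)
      (IsHomogeneous.sum _ _ _ fun i _ => ((hn i).map _).C_mul _) ?_
    simpa [C_mul', affineChart_eq_affineChart_map a b (f _)] using hc
  refine (Module.forall_dual_apply_eq_zero_iff k (c i)).1 fun l => ?_
  refine hf t (fun i => l (c i)) ?_ i hi
  ext u
  have := congrArg (fun G => l (coeff u G)) hsum
  simp only [coeff_sum, coeff_C_mul, coeff_map, map_sum, coeff_zero, map_zero] at this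
  rw [coeff_sum, coeff_zero, ← this]
  refine Finset.sum_congr rfl fun i _ => ?_
  rw [coeff_smul, mul_comm (c i), ← Algebra.smul_def, map_smul, smul_eq_mul, smul_eq_mul, mul_comm]

theorem exists_isHomogeneous_affineChart_eq {g : MvPolynomial (Fin 2) K} {n : ℕ}
    (hg : g ∈ degreeFiltration K n) :
    ∃ G : MvPolynomial (Fin 3) K, G.IsHomogeneous n ∧ affineChart K a b G = g := by
  refine ⟨∑ u ∈ g.support, C (coeff u g) * (X 0 ^ u 0 * X 1 ^ u 1 *
    lineAtInfinity a b ^ (n - (u 0 + u 1))), ?_, ?_⟩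
  · have hl : (lineAtInfinity a b).IsHomogeneous 1 :=
      ((isHomogeneous_X K 2).add ((isHomogeneous_X K 0).C_mul a)).add
        ((isHomogeneous_X K 1).C_mul b)
    refine IsHomogeneous.sum _ _ _ fun u hu => IsHomogeneous.C_mul ?_ _
    have hdeg : u 0 + u 1 ≤ n := by
      have := (le_totalDegree hu).trans (totalDegree_le_of_mem_degreeFiltration hg)
      rwa [Finsupp.sum_fintype _ _ (by simp), Fin.sum_univ_two] at this
    have := (((isHomogeneous_X K (0 : Fin 3)).pow (u 0)).mul
      ((isHomogeneous_X K (1 : Fin 3)).pow (u 1))).mul (hl.pow (n - (u 0 + u 1)))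
    convert this using 1
    omega
  · have hl : affineChart K a b (lineAtInfinity a b) = 1 := by
      simp [affineChart, lineAtInfinity]
      ring
    rw [map_sum]
    conv_rhs => rw [as_sum g]
    refine Finset.sum_congr rfl fun u _ => ?_
    rw [monomial_eq, Finsupp.prod_fintype _ _ (by simp), Fin.prod_univ_two]
    simp only [map_mul, map_pow, hl, one_pow, mul_one]
    simp [affineChart]

theorem eq_zero_of_forall_eval_eq_zero {s : ℕ} {v : Fin s → Fin 3 → k} {n : ℕ}
    (hv : ∀ i, algebraMap k K (v i 2) + a * algebraMap k K (v i 0) +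
      b * algebraMap k K (v i 1) ≠ 0)
    (hn : ∀ F : MvPolynomial (Fin 3) k, F.IsHomogeneous n → (∀ i, eval (v i) F = 0) → F = 0)
    {g : MvPolynomial (Fin 2) K} (hg : g ∈ degreeFiltration K n)
    (h : ∀ i, eval (fun j : Fin 2 => algebraMap k K (v i j.castSucc) /
      (algebraMap k K (v i 2) + a * algebraMap k K (v i 0) + b * algebraMap k K (v i 1))) g = 0) :
    g = 0 := by
  obtain ⟨G, hG, rfl⟩ := exists_isHomogeneous_affineChart_eq a b hg
  suffices G = 0 by rw [this, map_zero]
  have hGv : ∀ i, eval (fun j => algebraMap k K (v i j)) G = 0 := by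
    intro i
    have := eval_affineChart (k := K) a b hG (v := fun j => algebraMap k K (v i j)) (hv i)
    exact (mul_eq_zero.1 (this.symm.trans (h i))).resolve_left (pow_ne_zero _ (inv_ne_zero (hv i)))
  ext u
  rw [coeff_zero, ← Module.forall_dual_apply_eq_zero_iff k]
  intro l
  obtain ⟨H, hHc, hHe⟩ := exists_coeff_eq_apply_coeff l G
  have : H = 0 := by
    refine hn H (fun u hu => hG fun h0 => hu ?_) fun i => ?_
    · rw [hHc, h0, map_zero]
    · rw [hHe, hGv, map_zero]
  rw [← hHc, this, coeff_zero]

end AffineChart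

section InitialDegree

variable {k : Type*} [Field k]

theorem ratFunc_linearForm_ne_zero {v : Fin 3 → k} (hv : v ≠ 0) :
    algebraMap k (RatFunc k) (v 2) + RatFunc.X * algebraMap k (RatFunc k) (v 0) +
      RatFunc.X ^ 2 * algebraMap k (RatFunc k) (v 1) ≠ 0 := by
  intro h
  have hp : Polynomial.C (v 2) + Polynomial.X * Polynomial.C (v 0) +
      Polynomial.X ^ 2 * Polynomial.C (v 1) = 0 := by
    apply RatFunc.algebraMap_injective k
    rw [mul_comm RatFunc.X, mul_comm (RatFunc.X ^ 2)] at h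
    simpa [RatFunc.algebraMap_eq_C] using h
  have hc := fun m => congrArg (Polynomial.coeff · m) hp
  apply hv
  funext i
  fin_cases i
  · simpa [Polynomial.coeff_X_pow, Polynomial.coeff_C, Polynomial.coeff_X] using hc 1
  · simpa [Polynomial.coeff_X_pow, Polynomial.coeff_C, Polynomial.coeff_X] using hc 2
  · simpa [Polynomial.coeff_X_pow, Polynomial.coeff_C, Polynomial.coeff_X] using hc 0

theorem pairProducts_map {R S F ι : Type*} [CommSemiring R] [CommSemiring S] [FunLike F R S]
    [RingHomClass F R S] (φ : F) (f : ι → R) :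
    pairProducts (fun i => φ (f i)) = φ ∘ pairProducts f := by
  funext z
  induction z with
  | _ i j => simp

theorem linearIndependent_pairProducts_of_isHomogeneous {s n : ℕ} {v : Fin s → Fin 3 → k}
    (hv : ∀ i, v i ≠ 0)
    (hn : ∀ F : MvPolynomial (Fin 3) k, F.IsHomogeneous n → (∀ i, eval (v i) F = 0) → F = 0)
    {ι : Type*} {f : ι → MvPolynomial (Fin 3) k} (hf : LinearIndependent k f)
    (hdeg : ∀ i, (f i).IsHomogeneous (n + 1)) (hvan : ∀ i j, eval (v j) (f i) = 0) :
    LinearIndependent k (pairProducts f) := by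
  classical
  let a : RatFunc k := RatFunc.X
  let b : RatFunc k := RatFunc.X ^ 2
  have hl := fun i => ratFunc_linearForm_ne_zero (hv i)
  let q : Fin s → Fin 2 → RatFunc k := fun i j => algebraMap k (RatFunc k) (v i j.castSucc) /
    (algebraMap k (RatFunc k) (v i 2) + a * algebraMap k (RatFunc k) (v i 0) +
      b * algebraMap k (RatFunc k) (v i 1))
  have h : LinearIndependent (RatFunc k) (pairProducts fun i => affineChart k a b (f i)) := by
    refine linearIndependent_pairProducts_of_affine (Finset.univ.image q) n ?_
      (linearIndependent_affineChart a b hf hdeg)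
      (fun i => affineChart_mem_degreeFiltration a b (hdeg i)) ?_
    · exact fun g hg hgv => eq_zero_of_forall_eval_eq_zero a b hl hn hg fun i =>
        hgv (q i) (Finset.mem_image_of_mem q (Finset.mem_univ i))
    · intro i p hp
      obtain ⟨j, -, rfl⟩ := Finset.mem_image.1 hp
      exact (eval_affineChart a b (hdeg i) (hl j)).trans (by rw [hvan, map_zero, mul_zero])
  rw [pairProducts_map] at h
  exact LinearIndependent.of_comp (affineChart k a b).toLinearMap
    (h.restrict_scalars' k)

instance (I : Ideal (MvPolynomial (Fin 3) k)) (n : ℕ) : FiniteDimensional k (gradedPiece I n) :=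
  Submodule.finiteDimensional_of_le (S₂ := restrictTotalDegree (Fin 3) k n) fun F hF =>
    (mem_restrictTotalDegree (Fin 3) n F).2 (IsHomogeneous.totalDegree_le hF.2)

theorem finrank_mul_self_of_linearIndependent {A ι : Type*} [CommRing A] [Algebra k A] [Fintype ι]
    {V : Submodule k A} (f : Module.Basis ι k V)
    (h : LinearIndependent k (pairProducts fun i => (f i : A))) :
    Module.finrank k (V * V : Submodule k A) = (Module.finrank k V + 1).choose 2 := by
  classical
  have hV : Submodule.span k (Set.range fun i => (f i : A)) = V := by
    have := congrArg (Submodule.map V.subtype) f.span_eq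
    rwa [Submodule.map_span, ← Set.range_comp, Submodule.map_top, Submodule.range_subtype] at this
  conv_lhs => rw [← hV]
  rw [Submodule.span_mul_span, ← range_pairProducts, finrank_span_eq_card h, Sym2.card,
    Module.finrank_eq_card_basis f]

end InitialDegree

theorem points_square_initial_degree_dimension (k : Type*) [Field k] (s : ℕ) (hs : 1 ≤ s)
    (v : Fin s → (Fin 3 → k)) (hv0 : ∀ i, v i ≠ 0)
    (hvind : ∀ i j, i ≠ j → LinearIndependent k ![v i, v j])
    (α : ℕ) (hα : α = sInf {t : ℕ | gradedPiece (pointsIdeal v) t ≠ ⊥})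
    (d : ℕ) (hd : d = Module.finrank k (gradedPiece (pointsIdeal v) α)) :
    Module.finrank k (gradedPiece (pointsIdeal v ^ 2) (2 * α)) = Nat.choose (d + 1) 2 := by
  have hlt : ∀ n < α, gradedPiece (pointsIdeal v) n = ⊥ := fun n hn =>
    not_not.1 (Nat.notMem_of_lt_sInf (hα ▸ hn))
  rw [gradedPiece_sq _ α (fun F hF n => homogeneousComponent_mem_pointsIdeal v hF n) hlt, hd]
  refine finrank_mul_self_of_linearIndependent (Module.finBasis k _) ?_
  have hmem := fun i => (mem_gradedPiece_pointsIdeal hv0).1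
    (Module.finBasis k (gradedPiece (pointsIdeal v) α) i).2
  have hli := LinearIndependent.map'
    (Module.finBasis k (gradedPiece (pointsIdeal v) α)).linearIndependent (Submodule.subtype _)
    (Submodule.ker_subtype _)
  cases α with
  | succ n =>
    refine linearIndependent_pairProducts_of_isHomogeneous hv0 (n := n) (fun F hF hFv => ?_) hli
      (fun i => (hmem i).1) fun i => (hmem i).2
    have : F ∈ gradedPiece (pointsIdeal v) n := (mem_gradedPiece_pointsIdeal hv0).2 ⟨hF, hFv⟩
    rwa [hlt n n.lt_succ_self] at this
  | zero =>
    have hz : ∀ i, ((Module.finBasis k (gradedPiece (pointsIdeal v) 0) i :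
        gradedPiece (pointsIdeal v) 0) : MvPolynomial (Fin 3) k) = 0 := by
      intro i
      obtain ⟨h0, hev⟩ := hmem i
      rw [← totalDegree_zero_iff_isHomogeneous, totalDegree_eq_zero_iff_eq_C] at h0
      have := hev ⟨0, hs⟩
      rw [h0, eval_C] at this
      rw [h0, this, C_0]
    have : IsEmpty (Fin (Module.finrank k (gradedPiece (pointsIdeal v) 0))) :=
      ⟨fun i => hli.ne_zero i (hz i)⟩
    exact linearIndependent_empty_type
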